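/- arXiv:1808.09754 — 2 statements merged into one kernel-verified Lean document; each statement's English description precedes it below -/
import Mathlib

section
/- Let τ > √3 and let ρ_min be a minimizing measure with support M. Then there exist a finite set F ⊂ S² and finitely many injective real analytic curves γ_1, …, γ_n : (0,1) → S² such that M ⊆ F ∪ γ_1((0,1)) ∪ … ∪ γ_n((0,1)), and for all i ≠ j the intersection γ_i((0,1)) ∩ γ_j((0,1)) is a finite set. -/
open MeasureTheory Set
open scoped RealInnerProductSpace ENNReal

noncomputable section

/-- Euclidean three-space. -/
abbrev E3 := EuclideanSpace ℝ (Fin 3)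

/-- The unit sphere `S² ⊂ ℝ³`. -/
def Sphere2 : Set E3 := Metric.sphere 0 1

/-- The function `D(x,y) = (1/4)(1+⟨x,y⟩)(2 − τ²(1−⟨x,y⟩))`. -/
def Dfun (τ : ℝ) (x y : E3) : ℝ :=
  (1 / 4) * (1 + ⟪x, y⟫) * (2 - τ ^ 2 * (1 - ⟪x, y⟫))

/-- The Lagrangian `L = max(0, D)`. -/
def Lfun (τ : ℝ) (x y : E3) : ℝ := max 0 (Dfun τ x y)

/-- The causal action of a measure. -/
def causalAction (τ : ℝ) (ρ : Measure E3) : ℝ :=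
  ∫ x, ∫ y, Lfun τ x y ∂ρ ∂ρ

/-- `ρ` is a minimizing measure: a regular Borel probability measure supported on `S²`
minimizing the causal action among all such measures. -/
def IsMinimizer (τ : ℝ) (ρ : Measure E3) : Prop :=
  IsProbabilityMeasure ρ ∧ ρ.Regular ∧ ρ Sphere2ᶜ = 0 ∧
    ∀ ρ' : Measure E3, IsProbabilityMeasure ρ' → ρ'.Regular → ρ' Sphere2ᶜ = 0 →
      causalAction τ ρ ≤ causalAction τ ρ'

/-- The support of a measure. -/
def msupport (ρ : Measure E3) : Set E3 :=
  {x | ∀ U : Set E3, IsOpen U → x ∈ U → 0 < ρ U}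

/-- The opening angle `θ_max = arccos(1 − 2/τ²)`. -/
def θmax (τ : ℝ) : ℝ := Real.arccos (1 - 2 / τ ^ 2)

/-- The open light cone `I(p)`. -/
def lightConeI (τ : ℝ) (p : E3) : Set E3 := {q ∈ Sphere2 | 0 < Dfun τ p q}

/-- The boundary of the light cone `K(p)`. -/
def lightConeK (τ : ℝ) (p : E3) : Set E3 :=
  {q ∈ Sphere2 | ⟪p, q⟫ = Real.cos (θmax τ)}

/-- Make a point of `ℝ³` from coordinates. -/
def mkE3 (a b c : ℝ) : E3 := (WithLp.equiv 2 (Fin 3 → ℝ)).symm ![a, b, c]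

/-- A totally timelike set. -/
def TotallyTimelike (τ : ℝ) (Ω : Set E3) : Prop := ∀ x ∈ Ω, ∀ y ∈ Ω, 0 < Dfun τ x y

/-- `p` is an accumulation point of `A`: every neighborhood of `p` contains a point
of `A` different from `p`. -/
def AccumulationPt (p : E3) (A : Set E3) : Prop :=
  ∀ U ∈ nhds p, ∃ x ∈ A, x ∈ U ∧ x ≠ p

/-- `γ(0)` is a uniform two-sided accumulation point (of points of `M`) on `γ` of
scaling `β`, where `γ` is defined on `(−δ, δ)`. -/
def UniformTwoSidedAcc (M : Set E3) (β δ : ℝ) (γ : ℝ → E3) : Prop :=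
  ∃ ε₀ : ℝ, 0 < ε₀ ∧ ε₀ < δ ∧ ∀ ε : ℝ, 0 < ε → ε ≤ ε₀ →
    (∃ t ∈ Set.Ioo (-ε) (-(ε ^ (1 + β))), γ t ∈ M) ∧
    (∃ t ∈ Set.Ioo (ε ^ (1 + β)) ε, γ t ∈ M)

/-- The point `q₁ = (cos θ_max, 0, sin θ_max)`. -/
def q1pt (τ : ℝ) : E3 := mkE3 (Real.cos (θmax τ)) 0 (Real.sin (θmax τ))

/-- The point `q₂ = (cos θ_max, 0, −sin θ_max)`. -/
def q2pt (τ : ℝ) : E3 := mkE3 (Real.cos (θmax τ)) 0 (-Real.sin (θmax τ))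

/-- The curve `p_s = (cos s, sin s, 0)` along the equator. -/
def pcurve (s : ℝ) : E3 := mkE3 (Real.cos s) (Real.sin s) 0

/-- Geodesic ball in `S²` of radius `r` around `q`. -/
def geoBall (q : E3) (r : ℝ) : Set E3 := {x ∈ Sphere2 | Real.arccos ⟪q, x⟫ < r}

/-- The set `U_r = (B_r(q₁) ∪ B_r(q₂)) ∖ {q₁, q₂}`. -/
def Uset (τ r : ℝ) : Set E3 := (geoBall (q1pt τ) r ∪ geoBall (q2pt τ) r) \ {q1pt τ, q2pt τ}

/-- The set `I_r(q) = I(q) ∖ U_r`. -/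
def Iset (τ r : ℝ) (q : E3) : Set E3 := lightConeI τ q \ Uset τ r

/-- The point of `S²` with latitude `θ` (measured from the equator) and longitude `φ`. -/
def sphPt (θ φ : ℝ) : E3 :=
  mkE3 (Real.cos θ * Real.cos φ) (Real.cos θ * Real.sin φ) (Real.sin θ)

/-- The restrictions to `Ω` of polynomials of degree at most two on `ℝ³`. -/
def polyRestrictSet (Ω : Set E3) : Set (Ω → ℝ) :=
  {f | ∃ P : MvPolynomial (Fin 3) ℝ, P.totalDegree ≤ 2 ∧
        ∀ x : Ω, f x = MvPolynomial.eval (fun i => (x : E3) i) P}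

/-- The space `K(Ω)` of restrictions to `Ω` of polynomials of degree at most two. -/
def KSpace (Ω : Set E3) : Submodule ℝ (Ω → ℝ) := Submodule.span ℝ (polyRestrictSet Ω)

/-- Two-dimensional Hausdorff (surface) measure on `S²` restricted to `Ω`, as a
measure on `Ω`. -/
def surfΩ (Ω : Set E3) : Measure Ω := Measure.comap Subtype.val (μH[2] : Measure E3)

/-- The bilinear form `B(f,g) = ∫_Ω ∫_Ω D(x,y) f(x) g(y) dμ(x) dμ(y)` on functions on `Ω`. -/
def Bform (τ : ℝ) (Ω : Set E3) (f g : Ω → ℝ) : ℝ :=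
  ∫ x, ∫ y, Dfun τ (x : E3) (y : E3) * f x * g y ∂(surfΩ Ω) ∂(surfΩ Ω)

end


open Polynomial Polynomial.Bivariate in
lemma aux_alg (q : ℝ[X][Y]) (hq : q ≠ 0) : ∃ s : ℝ[X][Y], ∃ r : ℝ[X], r ≠ 0 ∧
    ∀ x, r.eval x ≠ 0 → (s.leadingCoeff.eval x ≠ 0 ∧
      (∀ y, q.evalEval x y = 0 → s.evalEval x y = 0) ∧
      (∀ y, s.evalEval x y = 0 → (derivative s).evalEval x y ≠ 0)) := by
  classical
  let K := FractionRing ℝ[X]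
  have inj : Function.Injective (algebraMap ℝ[X] K) := IsFractionRing.injective _ _
  have mapinj : Function.Injective (Polynomial.map (algebraMap ℝ[X] K)) :=
    Polynomial.map_injective _ inj
  have : CharZero K := charZero_of_injective_algebraMap inj
  have hq' : q.map (algebraMap ℝ[X] K) ≠ 0 := by
    intro h; apply hq; apply mapinj; simpa using h
  set p := UniqueFactorizationMonoid.radical (q.map (algebraMap ℝ[X] K)) with hp
  have hp0 : p ≠ 0 := UniqueFactorizationMonoid.radical_ne_zero
  have hsep : p.Separable := PerfectField.separable_iff_squarefree.2
    UniqueFactorizationMonoid.squarefree_radical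
  obtain ⟨n, t, hn⟩ := UniqueFactorizationMonoid.exists_dvd_radical_self_pow hq'
  rw [← hp] at hn
  have clear : ∀ g : K[X], ∃ b : ℝ[X], b ≠ 0 ∧ ∃ g' : ℝ[X][Y],
      g'.map (algebraMap ℝ[X] K) = C (algebraMap ℝ[X] K b) * g := by
    intro g
    obtain ⟨b, hb, h⟩ := IsLocalization.integerNormalization_spec (nonZeroDivisors ℝ[X]) g
    refine ⟨b, nonZeroDivisors.ne_zero hb, _, h.trans ?_⟩
    rw [← algebraMap_smul K b g, smul_eq_C_mul]
  obtain ⟨b, hb, s, hs⟩ := clear p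
  obtain ⟨c, hc, t', ht'⟩ := clear t
  obtain ⟨A, B, hAB⟩ := hsep
  obtain ⟨d, hd, A', hA'⟩ := clear A
  obtain ⟨e, he, B', hB'⟩ := clear B
  have hs0 : s ≠ 0 := by
    rintro rfl
    simp [hp0, hb] at hs
  have e1 : C c * s ^ n = C (b ^ n) * q * t' := by
    apply mapinj
    simp only [Polynomial.map_mul, Polynomial.map_pow, hs, ht', map_C, mul_pow, hn, map_pow]
    ring
  have e2 : C e * A' * s + C d * B' * derivative s = C (b * d * e) := by
    apply mapinj
    have : (derivative s).map (algebraMap ℝ[X] K) = C (algebraMap ℝ[X] K b) * derivative p := by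
      rw [← derivative_map, hs, derivative_C_mul]
    simp only [Polynomial.map_add, Polynomial.map_mul, hs, this, hA', hB', map_C, map_mul]
    linear_combination (C (algebraMap ℝ[X] K b) * C (algebraMap ℝ[X] K d) * C (algebraMap ℝ[X] K e)) * hAB
  refine ⟨s, b * c * d * e * s.leadingCoeff, ?_, ?_⟩
  · simp [hb, hc, hd, he, hs0]
  intro x hx
  simp only [eval_mul, mul_ne_zero_iff] at hx
  obtain ⟨⟨⟨⟨hbx, hcx⟩, hdx⟩, hex⟩, hlx⟩ := hx
  refine ⟨hlx, ?_, ?_⟩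
  · intro y hy
    have := congrArg (evalEval x y) e1
    simp [evalEval_mul, evalEval_pow, evalEval_C, hy, hcx] at this
    exact this.1
  · intro y hy h0
    have := congrArg (evalEval x y) e2
    simp [evalEval_mul, evalEval_add, evalEval_C, hy, h0, hbx, hdx, hex] at this

open scoped ContDiff in
lemma aux_ift (s : ℝ × ℝ → ℝ) (hs : ContDiff ℝ ω s) (x0 y0 : ℝ) (h0 : s (x0, y0) = 0) (d : ℝ)
    (hd : HasDerivAt (fun y => s (x0, y)) d y0) (hd0 : d ≠ 0) :
    ∃ φ : ℝ → ℝ, AnalyticAt ℝ φ x0 ∧ φ x0 = y0 ∧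
      ∀ᶠ z in nhds (x0, y0), (s z = 0 ↔ z.2 = φ z.1) := by
  have cdf : ContDiffAt ℝ ω s (x0, y0) := hs.contDiffAt
  have hf : HasFDerivAt s (fderiv ℝ s (x0, y0)) (x0, y0) :=
    (cdf.differentiableAt (by simp)).hasFDerivAt
  have h1 : (fderiv ℝ s (x0, y0) ∘L .inr ℝ ℝ ℝ) = ContinuousLinearMap.toSpanSingleton ℝ d := by
    have h2 : HasFDerivAt (fun y => s (x0, y)) (fderiv ℝ s (x0, y0) ∘L .inr ℝ ℝ ℝ) y0 :=
      HasFDerivAt.comp y0 hf (hasFDerivAt_prodMk_right x0 y0)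
    exact h2.unique hd.hasFDerivAt
  have hinv : (fderiv ℝ s (x0, y0) ∘L .inr ℝ ℝ ℝ).IsInvertible := by
    rw [h1]
    refine ⟨ContinuousLinearEquiv.unitsEquivAut ℝ (Units.mk0 d hd0), ?_⟩
    ext; simp
  refine ⟨cdf.implicitFunction (by simp) hinv, ?_, ?_, ?_⟩
  · exact (cdf.contDiffAt_implicitFunction (by simp) hinv).analyticAt
  · exact cdf.implicitFunction_apply_self (by simp) hinv
  · filter_upwards [cdf.eventually_apply_eq_iff_implicitFunction (by simp) hinv] with z hz
    rw [← h0, hz, eq_comm]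

open scoped ContDiff in
lemma aux_local (S : ℝ × ℝ → ℝ) (hS : ContDiff ℝ ω S) (x0 : ℝ) (N : ℕ) (e : Fin N → ℝ)
    (he : StrictMono e) (hroot : ∀ y, S (x0, y) = 0 ↔ ∃ i, y = e i)
    (hsimple : ∀ y, S (x0, y) = 0 → ∃ d, HasDerivAt (fun y => S (x0, y)) d y ∧ d ≠ 0)
    (C : ℝ) (hC : ∀ᶠ x in nhds x0, ∀ y, S (x, y) = 0 → |y| ≤ C) :
    ∃ φ : Fin N → ℝ → ℝ, (∀ i, AnalyticAt ℝ (φ i) x0) ∧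
      ∀ᶠ x in nhds x0, StrictMono (fun i => φ i x) ∧ ∀ y, S (x, y) = 0 ↔ ∃ i, y = φ i x := by
  have : ∀ i, ∃ φ : ℝ → ℝ, AnalyticAt ℝ φ x0 ∧ φ x0 = e i ∧
      ∀ᶠ z in nhds (x0, e i), (S z = 0 ↔ z.2 = φ z.1) := by
    intro i
    have h0 : S (x0, e i) = 0 := (hroot _).2 ⟨i, rfl⟩
    obtain ⟨d, hd, hd0⟩ := hsimple _ h0
    exact aux_ift S hS x0 (e i) h0 d hd hd0
  choose φ ha hv hev using this
  refine ⟨φ, ha, ?_⟩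
  have h1 : ∀ᶠ x in nhds x0, ∀ i j, i < j → φ i x < φ j x := by
    simp only [Filter.eventually_all]
    intro i j hij
    exact (ha i).continuousAt.eventually_lt (ha j).continuousAt (by rw [hv, hv]; exact he hij)
  have h2 : ∀ᶠ x in nhds x0, ∀ i, S (x, φ i x) = 0 := by
    rw [Filter.eventually_all]
    intro i
    have ht : Filter.Tendsto (fun x => (x, φ i x)) (nhds x0) (nhds (x0, e i)) := by
      have := (continuousAt_id (x := x0)).prodMk (ha i).continuousAt
      simpa [ContinuousAt, hv] using this
    filter_upwards [ht.eventually (hev i)] with x hx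
    exact hx.2 rfl
  have h3 : ∀ᶠ x in nhds x0, ∀ y ∈ Set.Icc (-C) C, S (x, y) = 0 → ∃ i, y = φ i x := by
    apply isCompact_Icc.eventually_forall_of_forall_eventually
    intro y _
    by_cases hy : S (x0, y) = 0
    · obtain ⟨i, rfl⟩ := (hroot y).1 hy
      filter_upwards [hev i] with z hz h
      exact ⟨i, hz.1 h⟩
    · filter_upwards [hS.continuous.continuousAt.eventually_ne hy] with z hz h
      exact absurd h hz
  filter_upwards [h1, h2, h3, hC] with x h1 h2 h3 hC
  refine ⟨fun i j h => h1 i j h, fun y => ⟨fun h => h3 y (abs_le.1 (hC y h)) h, ?_⟩⟩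
  rintro ⟨i, rfl⟩
  exact h2 i

lemma aux_graphs (U : Set ℝ) (hU : IsOpen U) (hc : IsPreconnected U) (R : ℝ → Finset ℝ)
    (hloc : ∀ x0 ∈ U, ∃ φ : Fin (R x0).card → ℝ → ℝ, (∀ i, AnalyticAt ℝ (φ i) x0) ∧
      ∀ᶠ x in nhds x0, StrictMono (fun i => φ i x) ∧ ∀ y, y ∈ R x ↔ ∃ i, y = φ i x) :
    ∃ N, ∃ g : Fin N → ℝ → ℝ, (∀ i, AnalyticOnNhd ℝ (g i) U) ∧
      ∀ x ∈ U, Function.Injective (fun i => g i x) ∧ ∀ y, y ∈ R x ↔ ∃ i, y = g i x := by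
  classical
  rcases U.eq_empty_or_nonempty with rfl | ⟨a, ha⟩
  · exact ⟨0, Fin.elim0, fun i => i.elim0, by simp⟩
  have hcard : ∀ x0 ∈ U, ∀ᶠ x in nhds x0, (R x).card = (R x0).card := by
    intro x0 hx0
    obtain ⟨φ, -, h⟩ := hloc x0 hx0
    filter_upwards [h] with x ⟨hx, hy⟩
    have : R x = Finset.univ.image (fun i => φ i x) := by
      ext y; rw [hy]; simp [eq_comm]
    rw [this, Finset.card_image_of_injective _ hx.injective]; simp
  have hconst : ∀ x ∈ U, (R x).card = (R a).card := by
    intro x hx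
    refine hc.constant (f := fun x => (R x).card) ?_ hx ha
    intro y hy
    apply ContinuousAt.continuousWithinAt
    rw [ContinuousAt, nhds_discrete ℕ, Filter.tendsto_pure]
    exact hcard y hy
  refine ⟨(R a).card, fun i x => if h : (R x).card = (R a).card then
    (R x).orderEmbOfFin h i else 0, ?_, ?_⟩
  · intro i x0 hx0
    obtain ⟨φ, hφ, h⟩ := hloc x0 hx0
    have h0 := hconst x0 hx0
    refine (hφ (Fin.cast h0.symm i)).congr ?_
    filter_upwards [h, hU.mem_nhds hx0] with x ⟨hx, hy⟩ hxU
    have h1 := hconst x hxU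
    rw [dif_pos h1]
    have := Finset.orderEmbOfFin_unique h1 (f := fun j => φ (Fin.cast h0.symm j) x)
      (fun j => (hy _).2 ⟨_, rfl⟩) (fun j k hjk => hx (by simpa using hjk))
    exact congrFun this i
  · intro x hx
    have h1 := hconst x hx
    simp only [dif_pos h1]
    refine ⟨((R x).orderEmbOfFin h1).injective, fun y => ?_⟩
    have := Finset.range_orderEmbOfFin (R x) h1
    rw [← Finset.mem_coe, ← this, Set.mem_range]
    exact exists_congr fun i => eq_comm

open Polynomial Polynomial.Bivariate in
lemma aux_bound (s : ℝ[X][Y]) (x0 : ℝ) (h : s.leadingCoeff.eval x0 ≠ 0) :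
    ∃ C : ℝ, ∀ᶠ x in nhds x0, ∀ y, s.evalEval x y = 0 → |y| ≤ C := by
  let b : ℝ → ℝ := fun x => ∑ i ∈ Finset.range s.natDegree, |(s.coeff i).eval x| / |s.leadingCoeff.eval x| + 1
  have hb : ContinuousAt b x0 := by
    apply ContinuousAt.add _ continuousAt_const
    apply tendsto_finsetSum
    intro i _
    exact ((s.coeff i).continuous.abs.continuousAt).div (s.leadingCoeff.continuous.abs.continuousAt) (by simpa using h)
  refine ⟨b x0 + 1, ?_⟩
  filter_upwards [hb.eventually_lt continuousAt_const (lt_add_one (b x0)),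
    s.leadingCoeff.continuous.continuousAt.eventually_ne h] with x hx hl y hy
  have hl' : evalRingHom x s.leadingCoeff ≠ 0 := hl
  have hdeg : (s.map (evalRingHom x)).natDegree = s.natDegree := natDegree_map_of_leadingCoeff_ne_zero _ hl'
  have hlead : (s.map (evalRingHom x)).leadingCoeff = s.leadingCoeff.eval x := by
    rw [leadingCoeff_map_of_leadingCoeff_ne_zero _ hl']; rfl
  have hroot : (s.map (evalRingHom x)).IsRoot y := by
    rw [IsRoot, map_evalRingHom_eval, hy]
  have hne : s.map (evalRingHom x) ≠ 0 := by
    intro h0; rw [h0] at hlead; simp at hlead; exact hl hlead.symm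
  have := hroot.norm_lt_cauchyBound hne
  have h2 : ((cauchyBound (s.map (evalRingHom x)) : NNReal) : ℝ) ≤ b x := by
    rw [cauchyBound]
    push_cast
    simp only [b]
    gcongr
    rw [hlead, hdeg, ← Finset.sum_div, Real.norm_eq_abs]
    gcongr
    have : (Finset.range s.natDegree).sup (fun i => ‖(s.map (evalRingHom x)).coeff i‖₊) ≤ ∑ i ∈ Finset.range s.natDegree, ‖(s.map (evalRingHom x)).coeff i‖₊ := by
      apply Finset.sup_le
      intro i hi
      exact Finset.single_le_sum (f := fun i => ‖(s.map (evalRingHom x)).coeff i‖₊) (fun _ _ => zero_le) hi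
    have h3 : (((Finset.range s.natDegree).sup (fun i => ‖(s.map (evalRingHom x)).coeff i‖₊) : NNReal) : ℝ) ≤ ((∑ i ∈ Finset.range s.natDegree, ‖(s.map (evalRingHom x)).coeff i‖₊ : NNReal) : ℝ) := by exact_mod_cast this
    refine h3.trans (le_of_eq ?_)
    push_cast
    simp
  have h4 : ‖y‖ < ((cauchyBound (s.map (evalRingHom x)) : NNReal) : ℝ) := by exact_mod_cast this
  rw [Real.norm_eq_abs] at h4
  linarith

open Polynomial Polynomial.Bivariate in
open scoped ContDiff in
lemma aux_contDiff (s : ℝ[X][Y]) : ContDiff ℝ ω (fun z : ℝ × ℝ => s.evalEval z.1 z.2) := by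
  have : (fun z : ℝ × ℝ => s.evalEval z.1 z.2) = fun z => ∑ i ∈ Finset.range (s.natDegree + 1), (s.coeff i).eval z.1 * z.2 ^ i := by
    funext z
    rw [evalEval, eval_eq_sum_range (p := s), eval_finsetSum]
    simp
  rw [this]
  apply ContDiff.sum
  intro i _
  apply ContDiff.mul
  · have h : ContDiff ℝ ω (fun x : ℝ => (s.coeff i).eval x) := by
      simpa using Polynomial.contDiff_aeval (s.coeff i) (𝕜 := ℝ) ω
    exact h.comp contDiff_fst
  · fun_prop

open Polynomial Polynomial.Bivariate in
lemma aux_interval (s : ℝ[X][Y]) (U : Set ℝ) (hU : IsOpen U) (hc : IsPreconnected U)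
    (h1 : ∀ x ∈ U, s.leadingCoeff.eval x ≠ 0)
    (h2 : ∀ x ∈ U, ∀ y, s.evalEval x y = 0 → (derivative s).evalEval x y ≠ 0) :
    ∃ N, ∃ g : Fin N → ℝ → ℝ, (∀ i, AnalyticOnNhd ℝ (g i) U) ∧
      ∀ x ∈ U, Function.Injective (fun i => g i x) ∧ ∀ y, s.evalEval x y = 0 ↔ ∃ i, y = g i x := by
  classical
  let R : ℝ → Finset ℝ := fun x => (s.map (evalRingHom x)).roots.toFinset
  have hR : ∀ x ∈ U, ∀ y, y ∈ R x ↔ s.evalEval x y = 0 := by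
    intro x hx y
    have hne : s.map (evalRingHom x) ≠ 0 := by
      intro h0
      have := leadingCoeff_map_of_leadingCoeff_ne_zero (evalRingHom x) (h1 x hx)
      rw [h0] at this; simp at this; exact h1 x hx this.symm
    simp only [R, Multiset.mem_toFinset, mem_roots hne, IsRoot, map_evalRingHom_eval]
  obtain ⟨N, g, hg, hg'⟩ := aux_graphs U hU hc R (by
    intro x0 hx0
    obtain ⟨C, hC⟩ := aux_bound s x0 (h1 x0 hx0)
    obtain ⟨φ, hφ, h⟩ := aux_local (fun z => s.evalEval z.1 z.2) (aux_contDiff s) x0 (R x0).card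
      ((R x0).orderEmbOfFin rfl) ((R x0).orderEmbOfFin rfl).strictMono (by
        intro y
        have := Finset.range_orderEmbOfFin (R x0) rfl
        simp only
        rw [← hR x0 hx0, ← Finset.mem_coe, ← this, Set.mem_range]
        exact exists_congr fun i => eq_comm) (by
        intro y hy
        refine ⟨_, ?_, h2 x0 hx0 y hy⟩
        have := (s.map (evalRingHom x0)).hasDerivAt y
        simpa [map_evalRingHom_eval, derivative_map] using this) C hC
    refine ⟨φ, hφ, ?_⟩
    filter_upwards [h, hU.mem_nhds hx0] with x hx hxU
    exact ⟨hx.1, fun y => by rw [hR x hxU]; exact hx.2 y⟩)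
  refine ⟨N, g, hg, fun x hx => ⟨(hg' x hx).1, fun y => ?_⟩⟩
  rw [← hR x hx, (hg' x hx).2]

lemma aux_tan_analytic {x : ℝ} (hx : Real.cos x ≠ 0) : AnalyticAt ℝ Real.tan x := by
  have : Real.tan = fun x => Real.sin x / Real.cos x := by
    funext x; exact Real.tan_eq_sin_div_cos x
  rw [this]
  exact Real.analyticAt_sin.div Real.analyticAt_cos hx

open Polynomial Polynomial.Bivariate in
lemma aux_plane (q : ℝ[X][Y]) (hq : q ≠ 0) :
    ∃ (ι : Type) (_ : Fintype ι) (γ : ι → ℝ → ℝ × ℝ),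
      (∀ i, AnalyticOnNhd ℝ (γ i) (Set.Ioo 0 1)) ∧
      (∀ i, Set.InjOn (γ i) (Set.Ioo 0 1)) ∧
      (∀ x y, q.evalEval x y = 0 → ∃ i, ∃ t ∈ Set.Ioo (0 : ℝ) 1, γ i t = (x, y)) ∧
      (∀ i j, ∀ t ∈ Set.Ioo (0 : ℝ) 1, ∀ t' ∈ Set.Ioo (0 : ℝ) 1, γ i t = γ j t' → i = j) := by
  classical
  obtain ⟨s, r, hr, H⟩ := aux_alg q hq
  let B : Finset ℝ := r.roots.toFinset
  have hB : ∀ x, x ∈ B ↔ r.eval x = 0 := by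
    intro x; simp [B, hr]
  let T : Finset ℝ := B.image Real.arctan ∪ {-(Real.pi / 2), Real.pi / 2}
  have hT : ∀ a ∈ T, -(Real.pi / 2) ≤ a ∧ a ≤ Real.pi / 2 := by
    intro a ha
    simp only [T, Finset.mem_union, Finset.mem_image, Finset.mem_insert, Finset.mem_singleton] at ha
    have := Real.pi_pos
    rcases ha with ⟨x, _, rfl⟩ | rfl | rfl
    · exact ⟨(Real.neg_pi_div_two_lt_arctan x).le, (Real.arctan_lt_pi_div_two x).le⟩
    · constructor <;> linarith
    · constructor <;> linarith
  let P : Finset (ℝ × ℝ) := (T ×ˢ T).filter (fun p => p.1 < p.2 ∧ ∀ c ∈ T, ¬ (p.1 < c ∧ c < p.2))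
  have hP : ∀ p : P, (p.1.1 ∈ T ∧ p.1.2 ∈ T) ∧ p.1.1 < p.1.2 ∧ ∀ c ∈ T, ¬ (p.1.1 < c ∧ c < p.1.2) := by
    intro p
    have := p.2
    simpa only [P, Finset.mem_filter, Finset.mem_product] using this
  let U : P → Set ℝ := fun p => Real.arctan ⁻¹' Set.Ioo p.1.1 p.1.2
  have hUB : ∀ p, ∀ x ∈ U p, r.eval x ≠ 0 := by
    intro p x hx h0
    have h1 : Real.arctan x ∈ T :=
      Finset.mem_union_left _ (Finset.mem_image_of_mem _ ((hB x).2 h0))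
    exact (hP p).2.2 _ h1 hx
  have hg : ∀ p : P, ∃ N, ∃ g : Fin N → ℝ → ℝ, (∀ i, AnalyticOnNhd ℝ (g i) (U p)) ∧
      ∀ x ∈ U p, Function.Injective (fun i => g i x) ∧
        ∀ y, s.evalEval x y = 0 ↔ ∃ i, y = g i x := by
    intro p
    apply aux_interval s (U p) (isOpen_Ioo.preimage Real.continuous_arctan)
    · exact (Set.ordConnected_Ioo.preimage_mono Real.arctan_strictMono.monotone).isPreconnected
    · intro x hx; exact (H x (hUB p x hx)).1
    · intro x hx; exact (H x (hUB p x hx)).2.2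
  choose N g hga hgr using hg
  have hθ : ∀ p : P, ∀ t ∈ Set.Ioo (0 : ℝ) 1, p.1.1 + t * (p.1.2 - p.1.1) ∈ Set.Ioo p.1.1 p.1.2 := by
    intro p t ht
    have h := (hP p).2.1
    constructor <;> nlinarith [ht.1, ht.2]
  have hθ' : ∀ p : P, ∀ t ∈ Set.Ioo p.1.1 p.1.2, t ∈ Set.Ioo (-(Real.pi / 2)) (Real.pi / 2) := by
    intro p t ht
    exact ⟨(hT _ (hP p).1.1).1.trans_lt ht.1, ht.2.trans_le (hT _ (hP p).1.2).2⟩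
  have harc : ∀ p : P, ∀ t ∈ Set.Ioo (0 : ℝ) 1,
      Real.arctan (Real.tan (p.1.1 + t * (p.1.2 - p.1.1))) = p.1.1 + t * (p.1.2 - p.1.1) := by
    intro p t ht
    have := hθ' p _ (hθ p t ht)
    exact Real.arctan_tan this.1 this.2
  have htU : ∀ p : P, ∀ t ∈ Set.Ioo (0 : ℝ) 1,
      Real.tan (p.1.1 + t * (p.1.2 - p.1.1)) ∈ U p := by
    intro p t ht
    show Real.arctan _ ∈ Set.Ioo p.1.1 p.1.2
    rw [harc p t ht]; exact hθ p t ht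
  have hpi : ∀ t ∈ Set.Ioo (0 : ℝ) 1, Real.pi * (t - 1 / 2) ∈ Set.Ioo (-(Real.pi / 2)) (Real.pi / 2) := by
    intro t ht
    have := Real.pi_pos
    constructor <;> nlinarith [ht.1, ht.2]
  let γ : ((Σ p : P, Fin (N p)) ⊕ B) → ℝ → ℝ × ℝ := fun k t =>
    match k with
    | Sum.inl ⟨p, i⟩ => (Real.tan (p.1.1 + t * (p.1.2 - p.1.1)),
        g p i (Real.tan (p.1.1 + t * (p.1.2 - p.1.1))))
    | Sum.inr c => (c.1, Real.tan (Real.pi * (t - 1 / 2)))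
  refine ⟨(Σ p : P, Fin (N p)) ⊕ B, inferInstance, γ, ?_, ?_, ?_, ?_⟩
  · rintro (⟨p, i⟩ | c) t ht
    · have h1 : AnalyticAt ℝ (fun t => Real.tan (p.1.1 + t * (p.1.2 - p.1.1))) t := by
        refine AnalyticAt.fun_comp (aux_tan_analytic ?_) (by fun_prop)
        exact (Real.cos_pos_of_mem_Ioo (hθ' p _ (hθ p t ht))).ne'
      exact h1.prod (AnalyticAt.fun_comp (hga p i _ (htU p t ht)) h1)
    · refine analyticAt_const.prod ?_
      refine AnalyticAt.fun_comp (aux_tan_analytic ?_) (by fun_prop)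
      exact (Real.cos_pos_of_mem_Ioo (hpi t ht)).ne'
  · rintro (⟨p, i⟩ | c) t ht t' ht' h
    · have h1 := congrArg (fun z => Real.arctan z.1) h
      simp only [γ] at h1
      rw [harc p t ht, harc p t' ht'] at h1
      have := sub_pos.2 (hP p).2.1
      have h2 : t * (p.1.2 - p.1.1) = t' * (p.1.2 - p.1.1) := by linarith
      exact mul_right_cancel₀ this.ne' h2
    · have h1 := congrArg (fun z => z.2) h
      simp only [γ] at h1
      have h2 := Real.injOn_tan (hpi t ht) (hpi t' ht') h1
      have := mul_left_cancel₀ Real.pi_pos.ne' h2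
      linarith
  · intro x y hxy
    by_cases hx : r.eval x = 0
    · refine ⟨Sum.inr ⟨x, (hB x).2 hx⟩, Real.arctan y / Real.pi + 1 / 2, ?_, ?_⟩
      · have h1 := Real.neg_pi_div_two_lt_arctan y
        have h2 := Real.arctan_lt_pi_div_two y
        have h3 := Real.pi_pos
        have h4 : -(1 / 2) < Real.arctan y / Real.pi := by rw [lt_div_iff₀ h3]; linarith
        have h5 : Real.arctan y / Real.pi < 1 / 2 := by rw [div_lt_iff₀ h3]; linarith
        constructor <;> linarith
      · simp only [γ, add_sub_cancel_right]
        rw [mul_div_cancel₀ _ Real.pi_pos.ne', Real.tan_arctan]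
    · have hnT : Real.arctan x ∉ T := by
        simp only [T, Finset.mem_union, Finset.mem_image, Finset.mem_insert, Finset.mem_singleton]
        rintro (⟨z, hz, hzx⟩ | h | h)
        · rw [Real.arctan_injective hzx] at hz; exact hx ((hB x).1 hz)
        · exact (Real.neg_pi_div_two_lt_arctan x).ne' h
        · exact (Real.arctan_lt_pi_div_two x).ne h
      have hA1 : (T.filter (· < Real.arctan x)).Nonempty :=
        ⟨-(Real.pi / 2), by simp [T, Real.neg_pi_div_two_lt_arctan x]⟩
      have hA2 : (T.filter (Real.arctan x < ·)).Nonempty :=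
        ⟨Real.pi / 2, by simp [T, Real.arctan_lt_pi_div_two x]⟩
      have ha := Finset.max'_mem _ hA1
      have hb := Finset.min'_mem _ hA2
      have ha' := Finset.le_max' (T.filter (· < Real.arctan x))
      have hb' := Finset.min'_le (T.filter (Real.arctan x < ·))
      set a := (T.filter (· < Real.arctan x)).max' hA1
      set b := (T.filter (Real.arctan x < ·)).min' hA2
      rw [Finset.mem_filter] at ha hb
      have hab : (a, b) ∈ P := by
        simp only [P, Finset.mem_filter, Finset.mem_product]
        refine ⟨⟨ha.1, hb.1⟩, ha.2.trans hb.2, ?_⟩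
        rintro c hc ⟨h1, h2⟩
        rcases lt_trichotomy c (Real.arctan x) with h | h | h
        · exact absurd (ha' c (Finset.mem_filter.2 ⟨hc, h⟩)) (not_le.2 h1)
        · exact hnT (h ▸ hc)
        · exact absurd (hb' c (Finset.mem_filter.2 ⟨hc, h⟩)) (not_le.2 h2)
      have hxU : x ∈ U ⟨(a, b), hab⟩ := ⟨ha.2, hb.2⟩
      obtain ⟨i, hi⟩ := ((hgr _ x hxU).2 y).1 ((H x hx).2.1 y hxy)
      have hlt : 0 < b - a := sub_pos.2 (ha.2.trans hb.2)
      refine ⟨Sum.inl ⟨⟨(a, b), hab⟩, i⟩, (Real.arctan x - a) / (b - a), ⟨?_, ?_⟩, ?_⟩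
      · exact div_pos (sub_pos.2 ha.2) hlt
      · rw [div_lt_one hlt]; linarith [hb.2]
      · simp only [γ]
        rw [div_mul_cancel₀ _ hlt.ne', add_sub_cancel, Real.tan_arctan, ← hi]
  · rintro (⟨p, i⟩ | c) (⟨p', i'⟩ | c') t ht t' ht' h
    · have h1 : Real.tan (p.1.1 + t * (p.1.2 - p.1.1)) = Real.tan (p'.1.1 + t' * (p'.1.2 - p'.1.1)) :=
        congrArg Prod.fst h
      have h2 : g p i (Real.tan (p.1.1 + t * (p.1.2 - p.1.1))) =
        g p' i' (Real.tan (p'.1.1 + t' * (p'.1.2 - p'.1.1))) := congrArg Prod.snd h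
      have m1 := htU p t ht
      have m2 := htU p' t' ht'
      rw [← h1] at m2 h2
      have hpp : p = p' := by
        have k1 : ∀ c ∈ T, ¬ (p.1.1 < c ∧ c < p.1.2) := (hP p).2.2
        have k2 : ∀ c ∈ T, ¬ (p'.1.1 < c ∧ c < p'.1.2) := (hP p').2.2
        have a1 := k1 _ (hP p').1.1
        have a2 := k1 _ (hP p').1.2
        have a3 := k2 _ (hP p).1.1
        have a4 := k2 _ (hP p).1.2
        have b1 : p.1.1 < _ := m1.1
        have b2 : _ < p.1.2 := m1.2
        have b3 : p'.1.1 < _ := m2.1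
        have b4 : _ < p'.1.2 := m2.2
        apply Subtype.ext
        apply Prod.ext
        · apply le_antisymm
          · by_contra hh; exact a3 ⟨not_le.1 hh, b1.trans b4⟩
          · by_contra hh; exact a1 ⟨not_le.1 hh, b3.trans b2⟩
        · apply le_antisymm
          · by_contra hh; exact a2 ⟨b1.trans b4, not_le.1 hh⟩
          · by_contra hh; exact a4 ⟨b3.trans b2, not_le.1 hh⟩
      subst hpp
      have := (hgr p _ m1).1 h2
      subst this
      rfl
    · have h1 : Real.tan (p.1.1 + t * (p.1.2 - p.1.1)) = c'.1 := congrArg Prod.fst h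
      exact absurd ((hB _).1 c'.2) (h1 ▸ hUB p _ (htU p t ht))
    · have h1 : c.1 = Real.tan (p'.1.1 + t' * (p'.1.2 - p'.1.1)) := congrArg Prod.fst h
      exact absurd ((hB _).1 c.2) (h1 ▸ hUB p' _ (htU p' t' ht'))
    · have h1 : c.1 = c'.1 := congrArg Prod.fst h
      rw [Subtype.ext h1]

lemma aux_ae_sphere {ρ : Measure E3} (h : ρ Sphere2ᶜ = 0) : ∀ᵐ x ∂ρ, x ∈ Sphere2 := by
  rw [ae_iff]; exact h

lemma aux_ae_sphere_prod {ρ : Measure E3} [IsProbabilityMeasure ρ] (h : ρ Sphere2ᶜ = 0) :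
    ∀ᵐ z ∂(ρ.prod ρ), z.1 ∈ Sphere2 ∧ z.2 ∈ Sphere2 :=
  (Measure.quasiMeasurePreserving_fst.ae (aux_ae_sphere h)).and
    (Measure.quasiMeasurePreserving_snd.ae (aux_ae_sphere h))

lemma aux_compact : IsCompact Sphere2 := isCompact_sphere 0 1

lemma aux_int1 {ρ : Measure E3} [IsProbabilityMeasure ρ] (h : ρ Sphere2ᶜ = 0) (f u : E3 → ℝ)
    (hf : Continuous f) (hu : Measurable u) (C : ℝ) (hC : ∀ x, |u x| ≤ C) :
    Integrable (fun x => u x * f x) ρ := by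
  obtain ⟨K, hK⟩ := aux_compact.exists_bound_of_continuousOn hf.continuousOn
  refine Integrable.of_bound (hu.mul hf.measurable).aestronglyMeasurable (C * K) ?_
  filter_upwards [aux_ae_sphere h] with x hx
  rw [norm_mul]
  exact mul_le_mul (hC x) (hK x hx) (norm_nonneg _) ((abs_nonneg _).trans (hC x))

lemma aux_int2 {ρ : Measure E3} [IsProbabilityMeasure ρ] (h : ρ Sphere2ᶜ = 0) (f u : E3 × E3 → ℝ)
    (hf : Continuous f) (hu : Measurable u) (C : ℝ) (hC : ∀ x, |u x| ≤ C) :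
    Integrable (fun x => u x * f x) (ρ.prod ρ) := by
  obtain ⟨K, hK⟩ := (aux_compact.prod aux_compact).exists_bound_of_continuousOn hf.continuousOn
  refine Integrable.of_bound (hu.mul hf.measurable).aestronglyMeasurable (C * K) ?_
  filter_upwards [aux_ae_sphere_prod h] with x hx
  rw [norm_mul]
  exact mul_le_mul (hC x) (hK x hx) (norm_nonneg _) ((abs_nonneg _).trans (hC x))

lemma aux_Lcont (τ : ℝ) : Continuous (fun z : E3 × E3 => Lfun τ z.1 z.2) := by
  unfold Lfun Dfun; fun_prop

/-- action of a density -/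
lemma aux_action {τ : ℝ} {ρ : Measure E3} (hmin : IsMinimizer τ ρ) (g : E3 → ℝ) (hg : Measurable g)
    (C : ℝ) (hC : ∀ x, |g x| ≤ C) (h0 : ∀ x, 0 ≤ g x) (h1 : ∫ x, g x ∂ρ = 1) :
    causalAction τ ρ ≤ ∫ z, (g z.1 * g z.2) * Lfun τ z.1 z.2 ∂(ρ.prod ρ) := by
  obtain ⟨hp, _, hS, H⟩ := hmin
  let ρ' := ρ.withDensity (fun x => ENNReal.ofReal (g x))
  have hgi : Integrable g ρ := by
    simpa using aux_int1 hS (fun _ => 1) g continuous_const hg C hC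
  have hp' : IsProbabilityMeasure ρ' := by
    constructor
    simp only [ρ']
    rw [withDensity_apply _ MeasurableSet.univ, Measure.restrict_univ,
      ← ofReal_integral_eq_lintegral_ofReal hgi (Filter.Eventually.of_forall h0), h1]
    simp
  have hS' : ρ' Sphere2ᶜ = 0 := withDensity_absolutelyContinuous _ _ hS
  refine (H ρ' hp' inferInstance hS').trans (le_of_eq ?_)
  have key : ∀ f : E3 → ℝ, ∫ x, f x ∂ρ' = ∫ x, g x * f x ∂ρ := by
    intro f
    simp only [ρ']
    rw [integral_withDensity_eq_integral_toReal_smul hg.ennreal_ofReal (by simp)]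
    simp [ENNReal.toReal_ofReal, h0]
  unfold causalAction
  rw [key]
  simp_rw [key]
  rw [integral_prod]
  · simp_rw [mul_assoc, integral_const_mul]
  · refine aux_int2 hS _ (fun z : E3 × E3 => g z.1 * g z.2) (aux_Lcont τ) (by fun_prop) (C * C) ?_
    intro z
    rw [abs_mul]
    exact mul_le_mul (hC _) (hC _) (abs_nonneg _) ((abs_nonneg _).trans (hC z.1))

lemma aux_key {τ : ℝ} {ρ : Measure E3} (hmin : IsMinimizer τ ρ) (h : E3 → ℝ) (hh : Measurable h)
    (C : ℝ) (hC : ∀ x, |h x| ≤ C) :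
    0 ≤ ∫ z, (h z.1 * h z.2) * Lfun τ z.1 z.2 ∂(ρ.prod ρ) := by
  have hmin' := hmin
  obtain ⟨hp, _, hS, -⟩ := hmin
  have hC0 : 0 ≤ C := (abs_nonneg _).trans (hC 0)
  have hhi : Integrable h ρ := by
    simpa using aux_int1 hS (fun _ => 1) h continuous_const hh C hC
  set m := ∫ x, h x ∂ρ with hm
  have hmC : |m| ≤ C := by
    have := norm_integral_le_of_norm_le_const (μ := ρ) (f := h) (C := C) (Filter.Eventually.of_forall hC)
    simpa using this
  set t : ℝ := 1 / (2 * (C + 1)) with ht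
  have ht0 : 0 < t := by positivity
  have htC : t * C ≤ 1 / 2 := by
    rw [ht, div_mul_eq_mul_div, div_le_div_iff₀ (by positivity) (by norm_num)]; linarith
  set Bm : (E3 × E3 → ℝ) → ℝ := fun u => ∫ z, u z * Lfun τ z.1 z.2 ∂(ρ.prod ρ) with hBm
  have hI : ∀ u : E3 × E3 → ℝ, Measurable u → ∀ K, (∀ z, |u z| ≤ K) →
      Integrable (fun z => u z * Lfun τ z.1 z.2) (ρ.prod ρ) :=
    fun u hu K hK => aux_int2 hS _ u (aux_Lcont τ) hu K hK
  have i1 := hI (fun _ => 1) measurable_const 1 (by simp)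
  have i2 := hI (fun z => h z.1 + h z.2) (by fun_prop) (C + C)
    (fun z => (abs_add_le _ _).trans (add_le_add (hC _) (hC _)))
  have i3 := hI (fun z => h z.1 * h z.2) (by fun_prop) (C * C) (fun z => by
    rw [abs_mul]; exact mul_le_mul (hC _) (hC _) (abs_nonneg _) hC0)
  have hSS : causalAction τ ρ = Bm (fun _ => 1) := by
    simp only [hBm]
    rw [integral_prod _ i1]
    simp [causalAction]
  have hpos : 0 ≤ Bm (fun _ => 1) := by
    simp only [hBm]
    apply integral_nonneg
    intro z
    simp [Lfun]
  have step : ∀ r : ℝ, |r| = t → (1 + r * m) ^ 2 * Bm (fun _ => 1) ≤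
      Bm (fun _ => 1) + r * Bm (fun z => h z.1 + h z.2) + r ^ 2 * Bm (fun z => h z.1 * h z.2) := by
    intro r hr
    have hrm : |r * m| ≤ 1 / 2 := by
      rw [abs_mul, hr]; exact (mul_le_mul_of_nonneg_left hmC ht0.le).trans htC
    have hrh : ∀ x, |r * h x| ≤ 1 / 2 := fun x => by
      rw [abs_mul, hr]; exact (mul_le_mul_of_nonneg_left (hC x) ht0.le).trans htC
    have hpm : 0 < 1 + r * m := by linarith [(abs_le.1 hrm).1]
    have hA := aux_action hmin' (fun x => (1 + r * h x) / (1 + r * m)) (by fun_prop)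
      ((3 / 2) / (1 + r * m)) (by
        intro x
        rw [abs_div, abs_of_pos hpm]
        gcongr
        refine abs_le.2 ⟨?_, ?_⟩ <;> linarith [(abs_le.1 (hrh x)).1, (abs_le.1 (hrh x)).2])
      (by intro x; apply div_nonneg _ hpm.le; linarith [(abs_le.1 (hrh x)).1])
      (by
        rw [integral_div, integral_add (integrable_const _) (hhi.const_mul r), integral_const_mul, ← hm]
        simp [hpm.ne'])
    have e : ∫ z, ((1 + r * h z.1) / (1 + r * m) * ((1 + r * h z.2) / (1 + r * m))) * Lfun τ z.1 z.2 ∂(ρ.prod ρ)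
        = (Bm (fun _ => 1) + r * Bm (fun z => h z.1 + h z.2) + r ^ 2 * Bm (fun z => h z.1 * h z.2)) / (1 + r * m) ^ 2 := by
      simp only [hBm]
      have a1 := integral_add i1 (i2.const_mul r)
      have a2 := integral_add (i1.add (i2.const_mul r)) (i3.const_mul (r ^ 2))
      simp only [Pi.add_apply] at a2
      rw [integral_const_mul r] at a1
      rw [integral_const_mul (r ^ 2)] at a2
      rw [← a1, ← a2, ← integral_div]
      congr 1
      funext z
      field_simp
      ring
    rw [e, hSS, le_div_iff₀ (by positivity)] at hA
    linarith
  have s1 := step t (abs_of_pos ht0)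
  have s2 := step (-t) (by rw [abs_neg, abs_of_pos ht0])
  have s3 : t ^ 2 * (m ^ 2 * Bm (fun _ => 1)) ≤ t ^ 2 * Bm (fun z => h z.1 * h z.2) := by nlinarith
  have s4 := le_of_mul_le_mul_left s3 (by positivity)
  exact (mul_nonneg (sq_nonneg m) hpos).trans s4

/-- the ten quadratic monomials -/
noncomputable def auxPhi : Fin 10 → E3 → ℝ :=
  ![fun _ => 1, fun x => x 0, fun x => x 1, fun x => x 2, fun x => x 0 ^ 2, fun x => x 1 ^ 2,
    fun x => x 2 ^ 2, fun x => x 0 * x 1, fun x => x 1 * x 2, fun x => x 2 * x 0]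

/-- the weights of `D` -/
noncomputable def auxEps (τ : ℝ) : Fin 10 → ℝ :=
  ![(2 - τ ^ 2) / 4, 1 / 2, 1 / 2, 1 / 2, τ ^ 2 / 4, τ ^ 2 / 4, τ ^ 2 / 4, τ ^ 2 / 2, τ ^ 2 / 2, τ ^ 2 / 2]

/-- the spherical mean functional -/
noncomputable def auxV : Fin 10 → ℝ := ![1, 0, 0, 0, 1 / 3, 1 / 3, 1 / 3, 0, 0, 0]

lemma aux_D_eq (τ : ℝ) (x y : E3) :
    Dfun τ x y = ∑ k, auxEps τ k * (auxPhi k x * auxPhi k y) := by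
  have : ⟪x, y⟫ = x 0 * y 0 + x 1 * y 1 + x 2 * y 2 := by
    simp [PiLp.inner_apply, Fin.sum_univ_three]; ring
  unfold Dfun
  rw [this]
  simp [Fin.sum_univ_succ, auxEps, auxPhi]
  ring

lemma aux_Phi_cont (k : Fin 10) : Continuous (auxPhi k) := by
  fin_cases k <;> simp [auxPhi] <;> fun_prop

lemma aux_D_nonneg {τ : ℝ} (hτ : 0 < τ) {p x y : E3} (hx : x ∈ Sphere2) (hy : y ∈ Sphere2)
    (hx' : x ∈ Metric.ball p (1 / τ)) (hy' : y ∈ Metric.ball p (1 / τ)) : 0 ≤ Dfun τ x y := by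
  have hx1 : ‖x‖ = 1 := by simpa [Sphere2] using hx
  have hy1 : ‖y‖ = 1 := by simpa [Sphere2] using hy
  have h1 : ‖x - y‖ ^ 2 = 2 - 2 * ⟪x, y⟫ := by
    rw [norm_sub_sq_real, hx1, hy1]; ring
  have h2 : ‖x - y‖ ≤ 2 / τ := by
    rw [← dist_eq_norm]
    have := dist_triangle_right x y p
    rw [Metric.mem_ball] at hx' hy'
    have e : 2 / τ = 1 / τ + 1 / τ := by ring
    linarith
  have h3 : ‖x - y‖ ^ 2 ≤ (2 / τ) ^ 2 := by gcongr
  have h4 : -1 ≤ ⟪x, y⟫ := by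
    have := abs_real_inner_le_norm x y
    rw [hx1, hy1] at this
    linarith [(abs_le.1 this).1]
  have h5 : τ ^ 2 * ‖x - y‖ ^ 2 ≤ 4 := by
    calc _ ≤ τ ^ 2 * (2 / τ) ^ 2 := by gcongr
      _ = 4 := by field_simp; norm_num
  unfold Dfun
  apply mul_nonneg
  · linarith
  · rw [h1] at h5; linarith

lemma aux_quadric {τ : ℝ} (hτ : Real.sqrt 3 < τ) {ρ : Measure E3} (hmin : IsMinimizer τ ρ)
    (p : E3) : ∃ a : Fin 10 → ℝ, ∑ k, a k * auxV k ≠ 0 ∧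
      ∀ x ∈ msupport ρ ∩ Metric.ball p (1 / τ), ∑ k, a k * auxPhi k x = 0 := by
  have hτ0 : 0 < τ := (Real.sqrt_nonneg 3).trans_lt hτ
  have hτ3 : 3 < τ ^ 2 := by
    have := Real.sq_sqrt (show (0 : ℝ) ≤ 3 by norm_num)
    have h0 := Real.sqrt_nonneg 3
    nlinarith
  have hmin' := hmin
  obtain ⟨hp, _, hS, -⟩ := hmin
  set Ω := Metric.ball p (1 / τ) with hΩ
  have hΩm : MeasurableSet Ω := Metric.isOpen_ball.measurableSet
  let h : (Fin 10 → ℝ) → E3 → ℝ := fun a => Ω.indicator (fun x => ∑ k, a k * auxPhi k x)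
  have hcont : ∀ a : Fin 10 → ℝ, Continuous (fun x => ∑ k, a k * auxPhi k x) := fun a =>
    continuous_finsetSum _ fun k _ => continuous_const.mul (aux_Phi_cont k)
  have hmeas : ∀ a, Measurable (h a) := fun a => (hcont a).measurable.indicator hΩm
  have hbd : ∀ a, ∃ C, ∀ x, |h a x| ≤ C := by
    intro a
    obtain ⟨K, hK⟩ := (isCompact_closedBall p (1 / τ)).exists_bound_of_continuousOn
      (hcont a).continuousOn
    refine ⟨max K 0, fun x => ?_⟩
    by_cases hx : x ∈ Ω
    · simp only [h, indicator_of_mem hx]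
      exact (hK x (Metric.ball_subset_closedBall hx)).trans (le_max_left _ _)
    · simp [h, indicator_of_notMem hx]
  have hint : ∀ a k, Integrable (fun x => h a x * auxPhi k x) ρ := by
    intro a k
    obtain ⟨C, hC⟩ := hbd a
    exact aux_int1 hS _ _ (aux_Phi_cont k) (hmeas a) C hC
  -- the moments
  have hadd : ∀ a b x, h (a + b) x = h a x + h b x := by
    intro a b x
    by_cases hx : x ∈ Ω
    · simp [h, indicator_of_mem hx, add_mul, Finset.sum_add_distrib]
    · simp [h, indicator_of_notMem hx]
  have hsmul : ∀ (c : ℝ) a x, h (c • a) x = c * h a x := by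
    intro c a x
    by_cases hx : x ∈ Ω
    · simp [h, indicator_of_mem hx, mul_assoc, Finset.mul_sum]
    · simp [h, indicator_of_notMem hx]
  let G : (Fin 10 → ℝ) →ₗ[ℝ] (Fin 10 → ℝ) :=
    { toFun := fun a k => ∫ x, h a x * auxPhi k x ∂ρ
      map_add' := by
        intro a b
        funext k
        simp only [Pi.add_apply]
        rw [← integral_add (hint a k) (hint b k)]
        simp_rw [hadd, add_mul]
      map_smul' := by
        intro c a
        funext k
        simp only [Pi.smul_apply, smul_eq_mul, RingHom.id_apply]
        rw [← integral_const_mul]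
        simp_rw [hsmul, mul_assoc] }
  have hG : ∀ a k, G a k = ∫ x, h a x * auxPhi k x ∂ρ := fun a k => rfl
  have hform : ∀ a, 0 ≤ ∑ k, auxEps τ k * (G a k * G a k) := by
    intro a
    obtain ⟨C, hC⟩ := hbd a
    refine (aux_key hmin' (h a) (hmeas a) C hC).trans (le_of_eq ?_)
    have e1 : ∫ z, (h a z.1 * h a z.2) * Lfun τ z.1 z.2 ∂(ρ.prod ρ) =
        ∫ z, ∑ k, auxEps τ k * ((h a z.1 * auxPhi k z.1) * (h a z.2 * auxPhi k z.2)) ∂(ρ.prod ρ) := by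
      apply integral_congr_ae
      filter_upwards [aux_ae_sphere_prod hS] with z hz
      have : ∑ k, auxEps τ k * ((h a z.1 * auxPhi k z.1) * (h a z.2 * auxPhi k z.2)) =
          (h a z.1 * h a z.2) * Dfun τ z.1 z.2 := by
        rw [aux_D_eq, Finset.mul_sum]
        exact Finset.sum_congr rfl fun k _ => by ring
      rw [this]
      by_cases h1 : z.1 ∈ Ω
      · by_cases h2 : z.2 ∈ Ω
        · rw [Lfun, max_eq_right (aux_D_nonneg hτ0 hz.1 hz.2 h1 h2)]
        · simp [h, indicator_of_notMem h2]
      · simp [h, indicator_of_notMem h1]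
    rw [e1, integral_finsetSum]
    · refine Finset.sum_congr rfl fun k _ => ?_
      rw [integral_const_mul, hG]
      rw [integral_prod_mul (fun x => h a x * auxPhi k x) (fun x => h a x * auxPhi k x)]
    · intro k _
      exact ((hint a k).mul_prod (hint a k)).const_mul _
  have hV : auxV ∉ LinearMap.range G := by
    rintro ⟨a, ha⟩
    have := hform a
    rw [ha] at this
    simp [Fin.sum_univ_succ, auxEps, auxV] at this
    linarith
  obtain ⟨f, hfv, hf⟩ := Submodule.exists_le_ker_of_notMem hV
  have hfe : ∀ w, f w = ∑ k, f (Pi.single k 1) * w k := by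
    intro w
    conv_lhs => rw [pi_eq_sum_univ' w]
    simp [map_sum, mul_comm]
  refine ⟨fun k => f (Pi.single k 1), by rw [← hfe]; exact hfv, ?_⟩
  set a : Fin 10 → ℝ := fun k => f (Pi.single k 1) with ha
  have h0 : f (G a) = 0 := hf ⟨a, rfl⟩
  rw [hfe] at h0
  have hsq : ∫ x, h a x * h a x ∂ρ = 0 := by
    rw [← h0]
    have : ∀ x, h a x * h a x = ∑ k, a k * (h a x * auxPhi k x) := by
      intro x
      by_cases hx : x ∈ Ω
      · have : h a x = ∑ k, a k * auxPhi k x := by simp [h, indicator_of_mem hx]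
        conv_lhs => rw [this]
        rw [this, Finset.mul_sum]
        exact Finset.sum_congr rfl fun k _ => by ring
      · simp [h, indicator_of_notMem hx]
    simp_rw [this]
    rw [integral_finsetSum _ (fun k _ => (hint a k).const_mul _)]
    simp_rw [integral_const_mul]
    rfl
  obtain ⟨C, hC⟩ := hbd a
  have hsqi : Integrable (fun x => h a x * h a x) ρ := by
    refine Integrable.of_bound ((hmeas a).mul (hmeas a)).aestronglyMeasurable (C * C) ?_
    refine Filter.Eventually.of_forall fun x => ?_
    rw [norm_mul]
    exact mul_le_mul (hC x) (hC x) (norm_nonneg _) ((abs_nonneg _).trans (hC x))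
  have hae := (integral_eq_zero_iff_of_nonneg (fun x => mul_self_nonneg _) hsqi).1 hsq
  rintro x ⟨hx, hxΩ⟩
  by_contra hne
  have hopen : IsOpen (Ω ∩ {x | ∑ k, a k * auxPhi k x ≠ 0}) :=
    Metric.isOpen_ball.inter (isOpen_ne.preimage (hcont a))
  have hpos := hx _ hopen ⟨hxΩ, hne⟩
  refine hpos.ne' (measure_mono_null ?_ (ae_iff.1 hae))
  rintro y ⟨hy, hyne⟩
  simp only [Set.mem_ofPred_eq, Pi.zero_apply, mul_self_eq_zero, h, indicator_of_mem hy]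
  exact hyne

/-- inverse stereographic projection -/
noncomputable def auxSig (z : ℝ × ℝ) : E3 :=
  mkE3 (2 * z.1 / (1 + z.1 ^ 2 + z.2 ^ 2)) (2 * z.2 / (1 + z.1 ^ 2 + z.2 ^ 2))
    ((z.1 ^ 2 + z.2 ^ 2 - 1) / (1 + z.1 ^ 2 + z.2 ^ 2))

lemma aux_mk0 (a b c : ℝ) : (mkE3 a b c) 0 = a := by simp [mkE3]
lemma aux_mk1 (a b c : ℝ) : (mkE3 a b c) 1 = b := by simp [mkE3]
lemma aux_mk2 (a b c : ℝ) : (mkE3 a b c) 2 = c := by simp [mkE3]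

lemma aux_sphere_iff (x : E3) : x ∈ Sphere2 ↔ x 0 ^ 2 + x 1 ^ 2 + x 2 ^ 2 = 1 := by
  have : ‖x‖ ^ 2 = x 0 ^ 2 + x 1 ^ 2 + x 2 ^ 2 := by
    rw [EuclideanSpace.norm_sq_eq]; simp [Fin.sum_univ_three]
  rw [← this]
  simp only [Sphere2, mem_sphere_zero_iff_norm]
  constructor
  · intro h; rw [h]; norm_num
  · intro h; exact (pow_eq_one_iff_of_nonneg (norm_nonneg x) two_ne_zero).1 h

lemma aux_sig_mem (z : ℝ × ℝ) : auxSig z ∈ Sphere2 := by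
  rw [aux_sphere_iff]
  have : 1 + z.1 ^ 2 + z.2 ^ 2 ≠ 0 := by positivity
  simp only [auxSig, aux_mk0, aux_mk1, aux_mk2]
  field_simp
  ring

lemma aux_sig_inj : Function.Injective auxSig := by
  intro z w h
  have hz : 0 < 1 + z.1 ^ 2 + z.2 ^ 2 := by positivity
  have hw : 0 < 1 + w.1 ^ 2 + w.2 ^ 2 := by positivity
  have h0 := congrArg (fun x : E3 => x 0) h
  have h1 := congrArg (fun x : E3 => x 1) h
  have h2 := congrArg (fun x : E3 => x 2) h
  simp only [auxSig, aux_mk0, aux_mk1, aux_mk2] at h0 h1 h2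
  rw [div_eq_div_iff hz.ne' hw.ne'] at h0 h1 h2
  have e : 1 + z.1 ^ 2 + z.2 ^ 2 = 1 + w.1 ^ 2 + w.2 ^ 2 := by linarith
  rw [e] at h0 h1
  have k0 := mul_right_cancel₀ hw.ne' h0
  have k1 := mul_right_cancel₀ hw.ne' h1
  exact Prod.ext (by linarith) (by linarith)

lemma aux_sig_surj {x : E3} (hx : x ∈ Sphere2) (h : x 2 ≠ 1) :
    auxSig (x 0 / (1 - x 2), x 1 / (1 - x 2)) = x := by
  rw [aux_sphere_iff] at hx
  have h1 : 1 - x 2 ≠ 0 := sub_ne_zero.2 (Ne.symm h)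
  have hw : 1 + (x 0 / (1 - x 2)) ^ 2 + (x 1 / (1 - x 2)) ^ 2 = 2 / (1 - x 2) := by
    field_simp
    linear_combination hx
  have hw' : (x 0 / (1 - x 2)) ^ 2 + (x 1 / (1 - x 2)) ^ 2 - 1 = 2 / (1 - x 2) - 2 := by linarith
  ext i
  fin_cases i
  · show auxSig _ 0 = x 0
    simp only [auxSig, aux_mk0, hw]
    field_simp
  · show auxSig _ 1 = x 1
    simp only [auxSig, aux_mk1, hw]
    field_simp
  · show auxSig _ 2 = x 2
    simp only [auxSig, aux_mk2, hw, hw']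
    field_simp
    ring

lemma aux_sig_analytic (z : ℝ × ℝ) : AnalyticAt ℝ auxSig z := by
  have h1 : AnalyticAt ℝ (fun z : ℝ × ℝ => z.1) z := analyticAt_fst
  have h2 : AnalyticAt ℝ (fun z : ℝ × ℝ => z.2) z := analyticAt_snd
  have h3 : AnalyticAt ℝ (fun z : ℝ × ℝ => 1 + z.1 ^ 2 + z.2 ^ 2) z :=
    (analyticAt_const.add (h1.pow 2)).add (h2.pow 2)
  have hne : 1 + z.1 ^ 2 + z.2 ^ 2 ≠ 0 := by positivity
  have h : AnalyticAt ℝ (fun z : ℝ × ℝ => (![2 * z.1 / (1 + z.1 ^ 2 + z.2 ^ 2),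
      2 * z.2 / (1 + z.1 ^ 2 + z.2 ^ 2),
      (z.1 ^ 2 + z.2 ^ 2 - 1) / (1 + z.1 ^ 2 + z.2 ^ 2)] : Fin 3 → ℝ)) z := by
    rw [analyticAt_pi_iff]
    intro i
    fin_cases i
    · exact AnalyticAt.div (analyticAt_const.mul h1) h3 hne
    · exact AnalyticAt.div (analyticAt_const.mul h2) h3 hne
    · exact AnalyticAt.div (((h1.pow 2).add (h2.pow 2)).sub analyticAt_const) h3 hne
  exact ((EuclideanSpace.equiv (Fin 3) ℝ).symm.analyticAt _).comp h

open Polynomial Polynomial.Bivariate in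
lemma aux_poly (a : Fin 10 → ℝ) : ∃ q : ℝ[X][Y], ∀ u v, q.evalEval u v =
    (1 + u ^ 2 + v ^ 2) ^ 2 * ∑ k, a k * auxPhi k (auxSig (u, v)) := by
  let U : ℝ[X][Y] := C X
  let V : ℝ[X][Y] := X
  let w : ℝ[X][Y] := 1 + U ^ 2 + V ^ 2
  let n0 : ℝ[X][Y] := U + U
  let n1 : ℝ[X][Y] := V + V
  let n2 : ℝ[X][Y] := U ^ 2 + V ^ 2 - 1
  let c : ℝ → ℝ[X][Y] := fun r => C (C r)
  refine ⟨c (a 0) * w ^ 2 + c (a 1) * n0 * w + c (a 2) * n1 * w + c (a 3) * n2 * w +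
    c (a 4) * n0 ^ 2 + c (a 5) * n1 ^ 2 + c (a 6) * n2 ^ 2 + c (a 7) * n0 * n1 +
    c (a 8) * n1 * n2 + c (a 9) * n2 * n0, fun u v => ?_⟩
  have hne : 1 + u ^ 2 + v ^ 2 ≠ 0 := by positivity
  simp [Fin.sum_univ_succ, auxPhi, auxSig, aux_mk0, aux_mk1, aux_mk2, U, V, w, n0, n1, n2, c,
    evalEval_add, evalEval_mul, evalEval_pow, evalEval_sub, evalEval_C]
  field_simp
  ring_nf

open Polynomial Polynomial.Bivariate in
lemma aux_poly_ne (a : Fin 10 → ℝ) (ha : ∑ k, a k * auxV k ≠ 0) : ∃ q : ℝ[X][Y], q ≠ 0 ∧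
    ∀ z : ℝ × ℝ, ∑ k, a k * auxPhi k (auxSig z) = 0 → q.evalEval z.1 z.2 = 0 := by
  obtain ⟨q, hq⟩ := aux_poly a
  refine ⟨q, ?_, fun z hz => by rw [hq, hz, mul_zero]⟩
  rintro rfl
  apply ha
  have H : ∀ x y z : ℝ, x ^ 2 + y ^ 2 + z ^ 2 = 1 → z ≠ 1 →
      ∑ k, a k * auxPhi k (mkE3 x y z) = 0 := by
    intro x y z h hz
    have hm : mkE3 x y z ∈ Sphere2 := by
      rw [aux_sphere_iff, aux_mk0, aux_mk1, aux_mk2]; exact h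
    have hs := aux_sig_surj hm (by rw [aux_mk2]; exact hz)
    rw [← hs]
    have h2 := hq ((mkE3 x y z) 0 / (1 - (mkE3 x y z) 2)) ((mkE3 x y z) 1 / (1 - (mkE3 x y z) 2))
    rw [evalEval_zero] at h2
    have hne : ∀ u v : ℝ, (1 + u ^ 2 + v ^ 2) ^ 2 ≠ 0 := fun u v => by positivity
    exact (mul_eq_zero.1 h2.symm).resolve_left (hne _ _)
  have p1 := H 1 0 0 (by norm_num) (by norm_num)
  have p2 := H (-1) 0 0 (by norm_num) (by norm_num)
  have p3 := H 0 (3 / 5) (4 / 5) (by norm_num) (by norm_num)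
  have p4 := H 0 (-(3 / 5)) (-(4 / 5)) (by norm_num) (by norm_num)
  have p5 := H 0 (-(4 / 5)) (3 / 5) (by norm_num) (by norm_num)
  have p6 := H 0 (4 / 5) (-(3 / 5)) (by norm_num) (by norm_num)
  simp [Fin.sum_univ_succ, auxPhi, auxV, aux_mk0, aux_mk1, aux_mk2] at p1 p2 p3 p4 p5 p6 ⊢
  linear_combination (1 / 6) * (p1 + p2 + p3 + p4 + p5 + p6)

/-- Theorem 1.1: for `τ > √3`, the support of any minimizing measure is
contained in a finite number of injective real analytic curves which intersect at a
finite number of points, together with a finite set of points. -/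
theorem stmt_0 (τ : ℝ) (hτ : Real.sqrt 3 < τ) (ρ : Measure E3) (hmin : IsMinimizer τ ρ) :
    ∃ (F : Set E3) (n : ℕ) (γ : Fin n → ℝ → E3),
      F.Finite ∧ F ⊆ Sphere2 ∧
      (∀ i, AnalyticOnNhd ℝ (γ i) (Set.Ioo 0 1)) ∧
      (∀ i, Set.InjOn (γ i) (Set.Ioo 0 1)) ∧
      (∀ i, ∀ t ∈ Set.Ioo (0 : ℝ) 1, γ i t ∈ Sphere2) ∧
      msupport ρ ⊆ F ∪ ⋃ i, γ i '' Set.Ioo 0 1 ∧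
      (∀ i j, i ≠ j → (γ i '' Set.Ioo 0 1 ∩ γ j '' Set.Ioo 0 1).Finite) := by
  classical
  have hτ0 : 0 < τ := (Real.sqrt_nonneg 3).trans_lt hτ
  have hS : ρ Sphere2ᶜ = 0 := hmin.2.2.1
  have hsup : msupport ρ ⊆ Sphere2 := by
    intro x hx
    by_contra h
    exact (hx Sphere2ᶜ aux_compact.isClosed.isOpen_compl h).ne' hS
  choose a ha1 ha2 using fun p => aux_quadric hτ hmin p
  choose Q hQ0 hQ using fun p => aux_poly_ne (a p) (ha1 p)
  obtain ⟨T, -, hT⟩ := aux_compact.elim_nhds_subcover (fun p => Metric.ball p (1 / τ))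
    (fun p _ => Metric.ball_mem_nhds p (by positivity))
  obtain ⟨ι, hι, γ, hγa, hγi, hγs, hγd⟩ := aux_plane (∏ p ∈ T, Q p)
    (Finset.prod_ne_zero_iff.2 fun p _ => hQ0 p)
  let e := Fintype.equivFin ι
  refine ⟨{mkE3 0 0 1}, Fintype.card ι, fun i t => auxSig (γ (e.symm i) t), Set.finite_singleton _,
    ?_, ?_, ?_, ?_, ?_, ?_⟩
  · rw [Set.singleton_subset_iff, aux_sphere_iff, aux_mk0, aux_mk1, aux_mk2]; norm_num
  · intro i t ht
    exact AnalyticAt.fun_comp (aux_sig_analytic _) (hγa _ t ht)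
  · intro i t ht t' ht' h
    exact hγi _ ht ht' (aux_sig_inj h)
  · intro i t _
    exact aux_sig_mem _
  · intro x hx
    have hxS := hsup hx
    by_cases h2 : x 2 = 1
    · left
      have h3 := (aux_sphere_iff x).1 hxS
      rw [h2] at h3
      have k0 : x 0 = 0 := by nlinarith [sq_nonneg (x 0), sq_nonneg (x 1)]
      have k1 : x 1 = 0 := by nlinarith [sq_nonneg (x 0), sq_nonneg (x 1)]
      rw [Set.mem_singleton_iff]
      ext i
      fin_cases i
      · exact k0.trans (aux_mk0 _ _ _).symm
      · exact k1.trans (aux_mk1 _ _ _).symm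
      · exact h2.trans (aux_mk2 _ _ _).symm
    · right
      have hs := aux_sig_surj hxS h2
      obtain ⟨p, hpT, hpx⟩ := Set.mem_iUnion₂.1 (hT hxS)
      have hq := hQ p (x 0 / (1 - x 2), x 1 / (1 - x 2)) (by rw [hs]; exact ha2 p x ⟨hx, hpx⟩)
      obtain ⟨i, t, ht, hit⟩ := hγs _ _ (by
        rw [Polynomial.evalEval_prod]
        exact Finset.prod_eq_zero hpT hq)
      refine Set.mem_iUnion.2 ⟨e i, t, ht, ?_⟩
      simp only [Equiv.symm_apply_apply]
      rw [hit, hs]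
  · intro i j hij
    convert Set.finite_empty
    rw [Set.eq_empty_iff_forall_notMem]
    rintro x ⟨⟨t, ht, rfl⟩, ⟨t', ht', h⟩⟩
    exact hij (e.symm.injective (hγd _ _ t ht t' ht' (aux_sig_inj h.symm)))
end

section
/- Let τ ≥ 1 and let ρ_min be a minimizing measure with support M, and define ℓ(x) = ∫_{S²} L(x,y) dρ_min(y). Then ℓ is Lipschitz continuous on S², ℓ(x) = inf_{S²} ℓ for every x ∈ M, and for every bounded measurable function ψ : S² → ℝ one has ∫_{S²}∫_{S²} L(x,y) ψ(x) ψ(y) dρ_min(x) dρ_min(y) ≥ 0. -/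
open MeasureTheory Set
open scoped RealInnerProductSpace ENNReal

lemma Lfun_cont (τ : ℝ) : Continuous (fun p : E3 × E3 => Lfun τ p.1 p.2) := by
  unfold Lfun Dfun
  fun_prop

lemma Lfun_nonneg (τ : ℝ) (x y : E3) : 0 ≤ Lfun τ x y := le_max_left _ _

lemma Lfun_symm (τ : ℝ) (x y : E3) : Lfun τ x y = Lfun τ y x := by
  unfold Lfun Dfun
  rw [real_inner_comm]

lemma Lfun_bound (τ : ℝ) (x y : E3) (hy : y ∈ Sphere2) :
    |Lfun τ x y| ≤ (1 + ‖x‖) * (2 + τ ^ 2 * (1 + ‖x‖)) := by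
  have hy1 : ‖y‖ = 1 := by simpa [Sphere2] using hy
  have hs : |⟪x, y⟫| ≤ ‖x‖ := by simpa [hy1] using abs_real_inner_le_norm x y
  rw [abs_of_nonneg (Lfun_nonneg _ _ _)]
  have hx := norm_nonneg x
  have ht := sq_nonneg τ
  unfold Lfun Dfun
  apply max_le
  · positivity
  · have h1 : |1 + ⟪x, y⟫| ≤ 1 + ‖x‖ := by
      rw [abs_le] at *; constructor <;> linarith
    have h3 : |1 - ⟪x, y⟫| ≤ 1 + ‖x‖ := by
      rw [abs_le] at *; constructor <;> linarith
    have h2 : |2 - τ ^ 2 * (1 - ⟪x, y⟫)| ≤ 2 + τ ^ 2 * (1 + ‖x‖) := by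
      rw [abs_le] at *; constructor <;> nlinarith
    calc _ ≤ |1 / 4 * (1 + ⟪x, y⟫) * (2 - τ ^ 2 * (1 - ⟪x, y⟫))| := le_abs_self _
      _ = 1 / 4 * (|1 + ⟪x, y⟫| * |2 - τ ^ 2 * (1 - ⟪x, y⟫)|) := by
        rw [abs_mul, abs_mul]; norm_num; ring
      _ ≤ 1 / 4 * ((1 + ‖x‖) * (2 + τ ^ 2 * (1 + ‖x‖))) := by gcongr
      _ ≤ _ := by
        have : 0 ≤ (1 + ‖x‖) * (2 + τ ^ 2 * (1 + ‖x‖)) := by positivity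
        linarith

lemma Lfun_bound2 (τ : ℝ) (x y : E3) (hx : x ∈ Sphere2) (hy : y ∈ Sphere2) :
    |Lfun τ x y| ≤ 4 + 4 * τ ^ 2 := by
  have hx1 : ‖x‖ = 1 := by simpa [Sphere2] using hx
  have := Lfun_bound τ x y hy
  rw [hx1] at this
  linarith

lemma Lfun_lip (τ : ℝ) (x x' y : E3) (hx : x ∈ Sphere2) (hx' : x' ∈ Sphere2) (hy : y ∈ Sphere2) :
    |Lfun τ x y - Lfun τ x' y| ≤ (1 + τ ^ 2) * ‖x - x'‖ := by
  have hx1 : ‖x‖ = 1 := by simpa [Sphere2] using hx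
  have hx1' : ‖x'‖ = 1 := by simpa [Sphere2] using hx'
  have hy1 : ‖y‖ = 1 := by simpa [Sphere2] using hy
  have hs : |⟪x, y⟫| ≤ 1 := by simpa [hy1, hx1] using abs_real_inner_le_norm x y
  have hs' : |⟪x', y⟫| ≤ 1 := by simpa [hy1, hx1'] using abs_real_inner_le_norm x' y
  have hd : |⟪x, y⟫ - ⟪x', y⟫| ≤ ‖x - x'‖ := by
    rw [← inner_sub_left]; simpa [hy1] using abs_real_inner_le_norm (x - x') y
  have ht := sq_nonneg τ
  unfold Lfun
  have h0 : |max 0 (Dfun τ x y) - max 0 (Dfun τ x' y)| ≤ |Dfun τ x y - Dfun τ x' y| := by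
    rw [max_comm 0, max_comm 0]
    exact abs_max_sub_max_le_abs _ _ _
  refine h0.trans ?_
  have e : Dfun τ x y - Dfun τ x' y
      = 1 / 4 * (2 + τ ^ 2 * (⟪x, y⟫ + ⟪x', y⟫)) * (⟪x, y⟫ - ⟪x', y⟫) := by
    unfold Dfun; ring
  rw [e, abs_mul]
  have : |1 / 4 * (2 + τ ^ 2 * (⟪x, y⟫ + ⟪x', y⟫))| ≤ 1 + τ ^ 2 := by
    rw [abs_le] at *; constructor <;> nlinarith
  gcongr

lemma int_L (τ : ℝ) (μ : Measure E3) [IsFiniteMeasure μ] (hμ : ∀ᵐ y ∂μ, y ∈ Sphere2)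
    (ψ : E3 → ℝ) (hψ : Measurable ψ) (C : ℝ) (hC : ∀ x, |ψ x| ≤ C) (x : E3) :
    Integrable (fun y => Lfun τ x y * ψ y) μ := by
  have hc : Continuous (fun y => Lfun τ x y) :=
    (Lfun_cont τ).comp (by fun_prop : Continuous fun y : E3 => (x, y))
  refine Integrable.of_bound (C := (1 + ‖x‖) * (2 + τ ^ 2 * (1 + ‖x‖)) * C)
    (hc.measurable.mul hψ).aestronglyMeasurable ?_
  filter_upwards [hμ] with y hy
  rw [Real.norm_eq_abs, abs_mul]
  exact mul_le_mul (Lfun_bound τ x y hy) (hC y) (abs_nonneg _) (by positivity)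

lemma int_L1 (τ : ℝ) (μ : Measure E3) [IsFiniteMeasure μ] (hμ : ∀ᵐ y ∂μ, y ∈ Sphere2) (x : E3) :
    Integrable (fun y => Lfun τ x y) μ := by
  simpa using int_L τ μ hμ (fun _ => 1) measurable_const 1 (by simp) x

lemma int_prod (τ : ℝ) (μ : Measure E3) [IsFiniteMeasure μ] (hμ : ∀ᵐ y ∂μ, y ∈ Sphere2)
    (ψ : E3 → ℝ) (hψ : Measurable ψ) (C : ℝ) (hC : ∀ x, |ψ x| ≤ C) :
    Integrable (fun p : E3 × E3 => Lfun τ p.1 p.2 * ψ p.2) (μ.prod μ) := by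
  refine Integrable.of_bound (C := (4 + 4 * τ ^ 2) * C)
    ((Lfun_cont τ).measurable.mul (hψ.comp measurable_snd)).aestronglyMeasurable ?_
  filter_upwards [Measure.quasiMeasurePreserving_fst.ae hμ,
    Measure.quasiMeasurePreserving_snd.ae hμ] with p h1 h2
  rw [Real.norm_eq_abs, abs_mul]
  exact mul_le_mul (Lfun_bound2 τ _ _ h1 h2) (hC _) (abs_nonneg _) (by positivity)

/-- Euler–Lagrange equations: `ℓ` is Lipschitz on `S²`, minimal on the
support, and the second variation is non-negative. -/
theorem stmt_2 (τ : ℝ) (hτ : 1 ≤ τ) (ρ : Measure E3) (hmin : IsMinimizer τ ρ)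
    (ℓ : E3 → ℝ) (hℓ : ∀ x, ℓ x = ∫ y, Lfun τ x y ∂ρ) :
    (∃ K : NNReal, LipschitzOnWith K ℓ Sphere2) ∧
    (∀ x ∈ msupport ρ, ℓ x = sInf (ℓ '' Sphere2)) ∧
    (∀ ψ : E3 → ℝ, Measurable ψ → (∃ C : ℝ, ∀ x, |ψ x| ≤ C) →
      0 ≤ ∫ x, ∫ y, Lfun τ x y * ψ x * ψ y ∂ρ ∂ρ) := by
  obtain ⟨hp, hreg, hsupp, hm⟩ := hmin
  have hae : ∀ᵐ y ∂ρ, y ∈ Sphere2 := by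
    rw [ae_iff]; exact hsupp
  have hclosed : IsClosed Sphere2 := Metric.isClosed_sphere
  have hS : causalAction τ ρ = ∫ x, ℓ x ∂ρ := by
    unfold causalAction; simp only [hℓ]
  have hℓint : Integrable ℓ ρ := by
    have := (int_prod τ ρ hae (fun _ => 1) measurable_const 1 (by simp)).integral_prod_left
    simpa [← hℓ] using this
  have hlip : ∀ x ∈ Sphere2, ∀ x' ∈ Sphere2, |ℓ x - ℓ x'| ≤ (1 + τ ^ 2) * ‖x - x'‖ := by
    intro x hx x' hx'
    rw [hℓ, hℓ, ← integral_sub (int_L1 τ ρ hae x) (int_L1 τ ρ hae x')]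
    have := norm_integral_le_of_norm_le_const (μ := ρ)
      (f := fun y => Lfun τ x y - Lfun τ x' y) (C := (1 + τ ^ 2) * ‖x - x'‖) (by
        filter_upwards [hae] with y hy
        exact Lfun_lip τ x x' y hx hx' hy)
    simpa using this
  set S := causalAction τ ρ with hSdef
  -- first variation
  have hge : ∀ x ∈ Sphere2, S ≤ ℓ x := by
    intro x hx
    have key : ∀ t : ℝ, 0 < t → t < 1 →
        S ≤ (1 - t) ^ 2 * S + 2 * t * (1 - t) * ℓ x + t ^ 2 * Lfun τ x x := by
      intro t ht0 ht1
      set μ : Measure E3 := ENNReal.ofReal (1 - t) • ρ + ENNReal.ofReal t • Measure.dirac x with hμ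
      have hμp : IsProbabilityMeasure μ := by
        constructor
        simp only [hμ, Measure.add_apply, Measure.smul_apply, measure_univ, smul_eq_mul, mul_one]
        rw [← ENNReal.ofReal_add (by linarith) (by linarith)]
        simp
      have hμs : μ Sphere2ᶜ = 0 := by
        simp [hμ, hsupp, hclosed.measurableSet, hx]
      have hint : ∀ f : E3 → ℝ, Integrable f ρ →
          ∫ y, f y ∂μ = (1 - t) * ∫ y, f y ∂ρ + t * f x := by
        intro f hf
        rw [hμ, integral_add_measure (hf.smul_measure ENNReal.ofReal_ne_top)
          ((integrable_dirac (by simp)).smul_measure ENNReal.ofReal_ne_top),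
          integral_smul_measure, integral_smul_measure, integral_dirac,
          ENNReal.toReal_ofReal (by linarith), ENNReal.toReal_ofReal ht0.le]
        simp
      have h1 := hm μ hμp inferInstance hμs
      have h2 : causalAction τ μ = (1 - t) ^ 2 * S + 2 * t * (1 - t) * ℓ x + t ^ 2 * Lfun τ x x := by
        unfold causalAction
        have e1 : ∀ z, ∫ y, Lfun τ z y ∂μ = (1 - t) * ℓ z + t * Lfun τ x z := by
          intro z
          rw [hint _ (int_L1 τ ρ hae z), ← hℓ, Lfun_symm τ z x]
        simp only [e1]
        have i1 : Integrable (fun z => (1 - t) * ℓ z) ρ := hℓint.const_mul _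
        have i2 : Integrable (fun z => t * Lfun τ x z) ρ := (int_L1 τ ρ hae x).const_mul _
        rw [hint (fun z => (1 - t) * ℓ z + t * Lfun τ x z) (i1.add i2), integral_add i1 i2, integral_const_mul, integral_const_mul,
          ← hS, ← hℓ]
        ring
      rw [h2] at h1
      exact h1
    by_contra hlt
    push Not at hlt
    set d := S - ℓ x with hd
    have hd0 : 0 < d := by linarith
    set A := |S - 2 * ℓ x + Lfun τ x x| + d with hA
    have hA0 : 0 < A := by positivity
    have hAle := le_abs_self (S - 2 * ℓ x + Lfun τ x x)
    have ht1 : d / A ≤ 1 := by rw [div_le_one hA0, hA]; linarith [abs_nonneg (S - 2 * ℓ x + Lfun τ x x)]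
    have ht0 : 0 < d / A := by positivity
    have hk2 := key (d / A / 2) (by positivity) (by linarith)
    set t := d / A / 2 with ht
    have htp : 0 < t := by positivity
    have htA : t * A = d / 2 := by rw [ht]; field_simp
    have h3 : 0 ≤ t * (t * (S - 2 * ℓ x + Lfun τ x x) - 2 * d) := by
      rw [hd]; nlinarith
    have h4 : 0 ≤ t * (S - 2 * ℓ x + Lfun τ x x) - 2 * d := nonneg_of_mul_nonneg_right h3 htp
    have h5 : t * (S - 2 * ℓ x + Lfun τ x x) ≤ t * A := by
      apply mul_le_mul_of_nonneg_left _ htp.le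
      linarith
    linarith
  have hℓae : ∀ᵐ x ∂ρ, ℓ x = S := by
    have h0 : ∫ x, (ℓ x - S) ∂ρ = 0 := by
      rw [integral_sub hℓint (integrable_const _), ← hS]; simp
    have h1 : 0 ≤ᵐ[ρ] fun x => ℓ x - S := by
      filter_upwards [hae] with x hx
      simpa using hge x hx
    have h2 := (integral_eq_zero_iff_of_nonneg_ae h1 (hℓint.sub (integrable_const _))).1 h0
    filter_upwards [h2] with x hx
    simpa [sub_eq_zero] using hx
  refine ⟨⟨⟨1 + τ ^ 2, by positivity⟩, ?_⟩, ?_, ?_⟩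
  · apply LipschitzOnWith.of_dist_le_mul
    intro x hx y hy
    rw [Real.dist_eq, dist_eq_norm]
    exact hlip x hx y hy
  · intro x hx
    have hxS : x ∈ Sphere2 := by
      by_contra h
      exact (hx _ hclosed.isOpen_compl h).ne' hsupp
    have hxeq : ℓ x = S := by
      refine le_antisymm ?_ (hge x hxS)
      by_contra hlt
      push Not at hlt
      have hK : 0 < 1 + τ ^ 2 := by positivity
      have hr : 0 < (ℓ x - S) / (1 + τ ^ 2) := div_pos (by linarith) hK
      have hpos := hx (Metric.ball x ((ℓ x - S) / (1 + τ ^ 2))) Metric.isOpen_ball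
        (Metric.mem_ball_self hr)
      have hfr : ∃ᵐ y ∂ρ, y ∈ Metric.ball x ((ℓ x - S) / (1 + τ ^ 2)) :=
        frequently_ae_mem_iff.2 hpos.ne'
      obtain ⟨y, hyb, hyS, hyl⟩ := (hfr.and_eventually (hae.and hℓae)).exists
      have := hlip x hxS y hyS
      rw [Metric.mem_ball, dist_comm, dist_eq_norm, lt_div_iff₀ hK] at hyb
      have := le_abs_self (ℓ x - ℓ y)
      rw [hyl] at *
      linarith
    rw [hxeq]
    have hl : IsLeast (ℓ '' Sphere2) S := by
      refine ⟨⟨x, hxS, hxeq⟩, ?_⟩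
      rintro _ ⟨y, hy, rfl⟩
      exact hge y hy
    exact hl.csInf_eq.symm
  · rintro ψ hψ ⟨C, hC⟩
    have hC0 : 0 ≤ C := (abs_nonneg _).trans (hC 0)
    set P : E3 → ℝ := fun x => ∫ y, Lfun τ x y * ψ y ∂ρ with hP
    have hPint : Integrable P ρ := (int_prod τ ρ hae ψ hψ C hC).integral_prod_left
    have hψint : Integrable ψ ρ := Integrable.of_bound (C := C) hψ.aestronglyMeasurable
      (Filter.Eventually.of_forall hC)
    set c := ∫ x, ψ x ∂ρ with hc
    have hbd : ∀ f : E3 → ℝ, Integrable f ρ → Integrable (fun x => ψ x * f x) ρ := fun f hf =>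
      hf.bdd_mul (c := C) hψ.aestronglyMeasurable (Filter.Eventually.of_forall hC)
    have hψℓ : ∫ x, ψ x * ℓ x ∂ρ = S * c := by
      rw [hc, ← integral_const_mul]
      apply integral_congr_ae
      filter_upwards [hℓae] with x hx
      rw [hx]; ring
    have hPi : ∫ x, P x ∂ρ = S * c := by
      rw [← hψℓ, hP]
      rw [integral_integral_swap (int_prod τ ρ hae ψ hψ C hC)]
      congr 1; ext y
      rw [integral_mul_const, hℓ, mul_comm]
      congr 2; ext x; exact Lfun_symm _ _ _
    have hQ : ∫ x, ∫ y, Lfun τ x y * ψ x * ψ y ∂ρ ∂ρ = ∫ x, ψ x * P x ∂ρ := by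
      congr 1; ext x
      rw [hP, ← integral_const_mul]
      congr 1; ext y; ring
    rw [hQ]
    set Q := ∫ x, ψ x * P x ∂ρ with hQd
    have hS0 : 0 ≤ S := by
      rw [hSdef]; unfold causalAction
      exact integral_nonneg fun x => integral_nonneg fun y => Lfun_nonneg _ _ _
    obtain ⟨t, ht0, htC⟩ : ∃ t : ℝ, 0 < t ∧ t * C < 1 := by
      refine ⟨1 / (C + 1), by positivity, ?_⟩
      rw [one_div, inv_mul_lt_iff₀ (by positivity)]; linarith
    have hg0 : ∀ x, 0 ≤ 1 + t * ψ x := by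
      intro x
      have := (abs_le.1 (hC x)).1
      nlinarith
    set m := 1 + t * c with hmdef
    have hgint : Integrable (fun x => 1 + t * ψ x) ρ :=
      (integrable_const _).add (hψint.const_mul t)
    have hgm : ∫ x, (1 + t * ψ x) ∂ρ = m := by
      rw [integral_add (integrable_const _) (hψint.const_mul t), integral_const_mul]; simp [hmdef, hc]
    have hm0 : 0 < m := by
      have : |c| ≤ C := by
        have := norm_integral_le_of_norm_le_const (μ := ρ) (f := ψ)
          (Filter.Eventually.of_forall hC)
        simpa using this
      have := (abs_le.1 this).1
      nlinarith
    set g : E3 → ℝ := fun x => (1 + t * ψ x) / m with hg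
    have hgm' : Measurable g := by fun_prop
    have hgnn : ∀ x, 0 ≤ g x := fun x => div_nonneg (hg0 x) hm0.le
    set μ : Measure E3 := ρ.withDensity (fun x => ENNReal.ofReal (g x)) with hμ
    have hμp : IsProbabilityMeasure μ := by
      constructor
      rw [hμ, withDensity_apply _ MeasurableSet.univ, Measure.restrict_univ,
        ← ofReal_integral_eq_lintegral_ofReal (hgint.div_const m)
          (Filter.Eventually.of_forall hgnn)]
      rw [integral_div, hgm, div_self hm0.ne']
      simp
    have hμs : μ Sphere2ᶜ = 0 := withDensity_absolutelyContinuous _ _ hsupp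
    have hint : ∀ f : E3 → ℝ, ∫ y, f y ∂μ = ∫ y, g y * f y ∂ρ := by
      intro f
      rw [hμ, integral_withDensity_eq_integral_toReal_smul (by fun_prop)
        (Filter.Eventually.of_forall fun _ => ENNReal.ofReal_lt_top)]
      congr 1; ext y
      rw [ENNReal.toReal_ofReal (hgnn y), smul_eq_mul]
    have h1 := hm μ hμp inferInstance hμs
    have h2 : causalAction τ μ = (S + 2 * t * S * c + t ^ 2 * Q) / m ^ 2 := by
      unfold causalAction
      have e1 : ∀ x, ∫ y, Lfun τ x y ∂μ = (ℓ x + t * P x) / m := by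
        intro x
        rw [hint, hℓ, hP, ← integral_const_mul, ← integral_add (int_L1 τ ρ hae x)
          ((int_L τ ρ hae ψ hψ C hC x).const_mul t), ← integral_div]
        congr 1; ext y; rw [hg]; ring
      simp only [e1]
      rw [hint]
      have e2 : ∀ x, g x * ((ℓ x + t * P x) / m)
          = ((ℓ x + t * P x) + (t * (ψ x * ℓ x) + t ^ 2 * (ψ x * P x))) / m ^ 2 := by
        intro x; rw [hg]; field_simp
      simp only [e2]
      have i1 := hPint.const_mul t
      have i2 := (hbd ℓ hℓint).const_mul t
      have i3 := (hbd P hPint).const_mul (t ^ 2)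
      have i4 : Integrable (fun x => ℓ x + t * P x) ρ := hℓint.add i1
      have i5 : Integrable (fun x => t * (ψ x * ℓ x) + t ^ 2 * (ψ x * P x)) ρ := i2.add i3
      rw [integral_div, integral_add i4 i5, integral_add hℓint i1,
        integral_add i2 i3, integral_const_mul, integral_const_mul, integral_const_mul,
        hψℓ, hPi, ← hS]
      ring
    rw [h2, le_div_iff₀ (by positivity)] at h1
    have h3 : S * (t * c) ^ 2 ≤ t ^ 2 * Q := by
      rw [hmdef] at h1; nlinarith
    have h4 : 0 ≤ t ^ 2 * Q := le_trans (by positivity) h3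
    exact nonneg_of_mul_nonneg_right h4 (by positivity)
end
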